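/- arXiv:1903.03106 — 2 statements merged into one kernel-verified Lean document; each statement's English description precedes it below -/
import Mathlib

section
/- Let K be an origin-symmetric convex body in R^d (d > 1), let r > 0, λ > 0, and N ≥ 2^d. If Q = {q_1,...,q_N} is a uniform contraction of P = {p_1,...,p_N} with separating value λ (i.e., ‖q_i − q_j‖_K ≤ λ ≤ ‖p_i − p_j‖_K for all i < j), then the Lebesgue volume of the union of the N balls of radius r (in the norm generated by K) centered at the q_i is at most the volume of the union of the N balls of radius r centered at the p_i. -/
open MeasureTheory Set
open scoped Pointwise

/-- The one-dimensional Brunn–Minkowski inequality. -/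
theorem volume_add_le_volume_of_add_mem {A B C : Set ℝ} (hA : MeasurableSet A)
    (hB : MeasurableSet B) (hA₀ : A.Nonempty) (hB₀ : B.Nonempty)
    (hC : ∀ x ∈ A, ∀ y ∈ B, x + y ∈ C) :
    volume A + volume B ≤ volume C := by
  obtain ⟨a₀, ha₀⟩ := hA₀
  obtain ⟨b₀, hb₀⟩ := hB₀
  have key : ∀ S ⊆ A, ∀ T ⊆ B, IsCompact S → IsCompact T → S.Nonempty → T.Nonempty →
      volume S + volume T ≤ volume C := by
    intro S hSA T hTB hS hT hS₀ hT₀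
    obtain ⟨a, ha, hamax⟩ := hS.exists_isGreatest hS₀
    obtain ⟨b, hb, hbmin⟩ := hT.exists_isLeast hT₀
    have hdisj : AEDisjoint volume ((fun x => x + b) '' S) ((fun y => a + y) '' T) := by
      refine measure_mono_null (t := {a + b}) ?_ (by simp)
      rintro _ ⟨⟨x, hx, rfl⟩, y, hy, hxy⟩
      have h1 := hamax hx
      have h2 := hbmin hy
      simp only at hxy ⊢
      rw [mem_singleton_iff]
      linarith
    have hmeas : NullMeasurableSet ((fun y => a + y) '' T) :=
      (hT.image (by fun_prop)).measurableSet.nullMeasurableSet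
    calc volume S + volume T
        = volume ((fun x => x + b) '' S) + volume ((fun y => a + y) '' T) := by
          simp [image_add_right, image_add_left]
      _ = volume ((fun x => x + b) '' S ∪ (fun y => a + y) '' T) :=
          (measure_union₀ hmeas hdisj).symm
      _ ≤ volume C := by
          apply measure_mono
          rintro _ (⟨x, hx, rfl⟩ | ⟨y, hy, rfl⟩)
          · exact hC _ (hSA hx) _ (hTB hb)
          · exact hC _ (hSA ha) _ (hTB hy)
  rw [hA.measure_eq_iSup_isCompact, hB.measure_eq_iSup_isCompact]
  simp only [iSup_and']
  refine ENNReal.biSup_add_biSup_le' ⟨∅, by simp⟩ ⟨∅, by simp⟩ ?_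
  rintro S ⟨hSA, hS⟩ T ⟨hTB, hT⟩
  refine le_trans ?_ (key (insert a₀ S) (insert_subset ha₀ hSA) (insert b₀ T)
    (insert_subset hb₀ hTB) (hS.insert _) (hT.insert _) (insert_nonempty _ _) (insert_nonempty _ _))
  gcongr <;> exact subset_insert _ _

theorem volume_weighted_add_le {A B C : Set ℝ} {a b : ℝ} (ha : 0 < a) (hb : 0 < b)
    (hA : MeasurableSet A) (hB : MeasurableSet B) (hA₀ : A.Nonempty) (hB₀ : B.Nonempty)
    (hC : ∀ x ∈ A, ∀ y ∈ B, a * x + b * y ∈ C) :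
    ENNReal.ofReal a * volume A + ENNReal.ofReal b * volume B ≤ volume C := by
  have h := volume_add_le_volume_of_add_mem (A := a • A) (B := b • B) (C := C)
    (hA.const_smul₀ a) (hB.const_smul₀ b) hA₀.smul_set hB₀.smul_set (by
      rintro _ ⟨x, hx, rfl⟩ _ ⟨y, hy, rfl⟩
      exact hC x hx y hy)
  simpa [Measure.addHaar_smul, abs_of_pos ha, abs_of_pos hb] using h

theorem lintegral_eq_lintegral_volume_ofReal_lt {f : ℝ → ENNReal} (hf : Measurable f)
    (hf₁ : ∀ x, f x ≤ 1) :
    ∫⁻ x, f x = ∫⁻ s in Ioi (0 : ℝ), volume {x | ENNReal.ofReal s < f x} := by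
  have hfin : ∀ x, f x ≠ ⊤ := fun x => ne_top_of_le_ne_top ENNReal.one_ne_top (hf₁ x)
  have h := lintegral_eq_lintegral_meas_lt volume (f := fun x => (f x).toReal)
    (.of_forall fun x => ENNReal.toReal_nonneg) hf.ennreal_toReal.aemeasurable
  simp only [ENNReal.ofReal_toReal (hfin _)] at h
  rw [h]
  refine setLIntegral_congr_fun measurableSet_Ioi fun s hs => ?_
  simp only [ENNReal.ofReal_lt_iff_lt_toReal (le_of_lt hs) (hfin _)]

theorem ofReal_lt_rpow_mul_rpow {s a b : ℝ} {u v : ENNReal} (ha : 0 < a) (hb : 0 < b)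
    (hab : a + b = 1) (hu : ENNReal.ofReal s < u) (hv : ENNReal.ofReal s < v) :
    ENNReal.ofReal s < u ^ a * v ^ b := by
  calc ENNReal.ofReal s = ENNReal.ofReal s ^ a * ENNReal.ofReal s ^ b := by
        rw [← ENNReal.rpow_add_of_nonneg _ _ ha.le hb.le, hab, ENNReal.rpow_one]
    _ < u ^ a * v ^ b :=
        ENNReal.mul_lt_mul (ENNReal.rpow_lt_rpow hu ha) (ENNReal.rpow_lt_rpow hv hb)

theorem lintegral_weighted_add_le_of_iSup_eq_one {f g h : ℝ → ENNReal} {a b : ℝ} (ha : 0 < a)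
    (hb : 0 < b) (hab : a + b = 1) (hf : Measurable f) (hg : Measurable g) (hh : Measurable h)
    (hf₁ : ⨆ x, f x = 1) (hg₁ : ⨆ x, g x = 1)
    (hfgh : ∀ x y, f x ^ a * g y ^ b ≤ h (a * x + b * y)) :
    ENNReal.ofReal a * (∫⁻ x, f x) + ENNReal.ofReal b * (∫⁻ x, g x) ≤ ∫⁻ x, h x := by
  have hfle : ∀ x, f x ≤ 1 := fun x => hf₁ ▸ le_iSup f x
  have hgle : ∀ x, g x ≤ 1 := fun x => hg₁ ▸ le_iSup g x
  have hmeas : ∀ F : ℝ → ENNReal, Measurable fun s : ℝ => volume {x | ENNReal.ofReal s < F x} := by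
    intro F
    refine Antitone.measurable fun s t hst => measure_mono fun x hx => ?_
    exact lt_of_le_of_lt (ENNReal.ofReal_le_ofReal hst) hx
  refine le_trans ?_ (lintegral_mono fun x => min_le_left (h x) 1)
  rw [lintegral_eq_lintegral_volume_ofReal_lt hf hfle,
    lintegral_eq_lintegral_volume_ofReal_lt hg hgle,
    lintegral_eq_lintegral_volume_ofReal_lt (hh.min measurable_const) fun x => min_le_right _ _,
    ← lintegral_const_mul _ (hmeas f), ← lintegral_const_mul _ (hmeas g),
    ← lintegral_add_left ((hmeas f).const_mul _)]
  refine lintegral_mono fun s => ?_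
  rcases le_or_gt 1 s with hs | hs
  · have h1 : 1 ≤ ENNReal.ofReal s := by simpa using hs
    have hemp : ∀ F : ℝ → ENNReal, (∀ x, F x ≤ 1) → {x | ENNReal.ofReal s < F x} = ∅ :=
      fun F hF => eq_empty_of_forall_notMem fun x hx =>
        (lt_irrefl _ (lt_of_lt_of_le hx ((hF x).trans h1)))
    simp [hemp f hfle, hemp g hgle]
  · have hs' : ENNReal.ofReal s < 1 := by simpa using hs
    refine volume_weighted_add_le ha hb (measurableSet_lt measurable_const hf)
      (measurableSet_lt measurable_const hg) (lt_iSup_iff.1 (hs'.trans_eq hf₁.symm))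
      (lt_iSup_iff.1 (hs'.trans_eq hg₁.symm)) fun x hx y hy => lt_min ?_ hs'
    exact (ofReal_lt_rpow_mul_rpow ha hb hab hx hy).trans_le (hfgh x y)

theorem ENNReal.rpow_mul_rpow_le_weighted_add {a b : ℝ} (ha : 0 < a) (hb : 0 < b)
    (hab : a + b = 1) (u v : ENNReal) :
    u ^ a * v ^ b ≤ ENNReal.ofReal a * u + ENNReal.ofReal b * v := by
  have ha' : ENNReal.ofReal a ≠ 0 := by simpa using ha
  have hb' : ENNReal.ofReal b ≠ 0 := by simpa using hb
  induction u with
  | top => simp [ENNReal.mul_top ha']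
  | coe u =>
    induction v with
    | top => simp [ENNReal.mul_top hb']
    | coe v =>
      have h := NNReal.geom_mean_le_arith_mean2_weighted a.toNNReal b.toNNReal u v
        (by rw [← Real.toNNReal_add ha.le hb.le, hab, Real.toNNReal_one])
      rw [Real.coe_toNNReal a ha.le, Real.coe_toNNReal b hb.le] at h
      rw [← ENNReal.coe_rpow_of_nonneg _ ha.le, ← ENNReal.coe_rpow_of_nonneg _ hb.le]
      unfold ENNReal.ofReal
      exact_mod_cast h

theorem prekopaLeindler_real_of_iSup_ne_top {f g h : ℝ → ENNReal} {a b : ℝ} (ha : 0 < a)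
    (hb : 0 < b) (hab : a + b = 1) (hf : Measurable f) (hg : Measurable g) (hh : Measurable h)
    (hf₁ : ⨆ x, f x ≠ ⊤) (hg₁ : ⨆ x, g x ≠ ⊤)
    (hfgh : ∀ x y, f x ^ a * g y ^ b ≤ h (a * x + b * y)) :
    (∫⁻ x, f x) ^ a * (∫⁻ x, g x) ^ b ≤ ∫⁻ x, h x := by
  set M := ⨆ x, f x with hM
  set L := ⨆ x, g x with hL
  rcases eq_or_ne M 0 with hM0 | hM0
  · have : f = 0 := by ext x; exact ENNReal.iSup_eq_zero.1 hM0 x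
    simp [this, ha]
  rcases eq_or_ne L 0 with hL0 | hL0
  · have : g = 0 := by ext x; exact ENNReal.iSup_eq_zero.1 hL0 x
    simp [this, hb]
  set c := M ^ a * L ^ b with hc
  have hMa0 : M ^ a ≠ 0 := by simp [hM0, hf₁]
  have hLb0 : L ^ b ≠ 0 := by simp [hL0, hg₁]
  have hMat : M ^ a ≠ ⊤ := ENNReal.rpow_ne_top_of_nonneg ha.le hf₁
  have hLbt : L ^ b ≠ ⊤ := ENNReal.rpow_ne_top_of_nonneg hb.le hg₁
  have hcinv : c⁻¹ = (M⁻¹) ^ a * (L⁻¹) ^ b := by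
    rw [hc, ENNReal.mul_inv (.inl hMa0) (.inl hMat), ENNReal.inv_rpow, ENNReal.inv_rpow]
  have hc0 : c ≠ 0 := mul_ne_zero hMa0 hLb0
  have hct : c ≠ ⊤ := ENNReal.mul_ne_top hMat hLbt
  have hscale : ∀ u v : ENNReal, (M⁻¹ * u) ^ a * (L⁻¹ * v) ^ b = c⁻¹ * (u ^ a * v ^ b) := by
    intro u v
    rw [ENNReal.mul_rpow_of_nonneg _ _ ha.le, ENNReal.mul_rpow_of_nonneg _ _ hb.le, hcinv]
    ring
  have key := lintegral_weighted_add_le_of_iSup_eq_one (f := fun x => M⁻¹ * f x)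
    (g := fun x => L⁻¹ * g x) (h := fun x => c⁻¹ * h x) ha hb hab (hf.const_mul _)
    (hg.const_mul _) (hh.const_mul _)
    (by rw [← ENNReal.mul_iSup, ← hM, ENNReal.inv_mul_cancel hM0 hf₁])
    (by rw [← ENNReal.mul_iSup, ← hL, ENNReal.inv_mul_cancel hL0 hg₁])
    (fun x y => by rw [hscale]; gcongr; exact hfgh x y)
  have key' := (ENNReal.rpow_mul_rpow_le_weighted_add ha hb hab _ _).trans key
  rw [lintegral_const_mul _ hf, lintegral_const_mul _ hg, lintegral_const_mul _ hh, hscale] at key'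
  rwa [ENNReal.mul_le_mul_iff_right (ENNReal.inv_ne_zero.2 hct) (ENNReal.inv_ne_top.2 hc0)] at key'

/-- The Prékopa–Leindler inequality on the real line. -/
theorem prekopaLeindler_real {f g h : ℝ → ENNReal} {a b : ℝ} (ha : 0 < a)
    (hb : 0 < b) (hab : a + b = 1) (hf : Measurable f) (hg : Measurable g) (hh : Measurable h)
    (hfgh : ∀ x y, f x ^ a * g y ^ b ≤ h (a * x + b * y)) :
    (∫⁻ x, f x) ^ a * (∫⁻ x, g x) ^ b ≤ ∫⁻ x, h x := by
  have hmono : ∀ F : ℝ → ENNReal, Monotone fun (n : ℕ) x => min (F x) n :=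
    fun F m n hmn x => min_le_min le_rfl (by exact_mod_cast hmn)
  have htrunc : ∀ (F : ℝ → ENNReal), Measurable F →
      ∫⁻ x, F x = ⨆ n : ℕ, ∫⁻ x, min (F x) n := by
    intro F hF
    rw [← lintegral_iSup (fun n => hF.min measurable_const) (hmono F)]
    congr with x
    rw [← inf_iSup_eq, ENNReal.iSup_natCast, inf_top_eq]
  have hpow : ∀ (c : ℝ), 0 < c → ∀ u : ℕ → ENNReal, (⨆ n, u n) ^ c = ⨆ n, u n ^ c :=
    fun c hc u => (ENNReal.orderIsoRpow c hc).map_iSup u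
  rw [htrunc f hf, htrunc g hg, hpow a ha, hpow b hb, ENNReal.iSup_mul]
  refine iSup_le fun m => ?_
  rw [ENNReal.mul_iSup]
  refine iSup_le fun n => ?_
  refine prekopaLeindler_real_of_iSup_ne_top ha hb hab (hf.min measurable_const)
    (hg.min measurable_const) hh
    (ne_top_of_le_ne_top (ENNReal.natCast_ne_top m) (iSup_le fun x => min_le_right _ _))
    (ne_top_of_le_ne_top (ENNReal.natCast_ne_top n) (iSup_le fun x => min_le_right _ _))
    fun x y => le_trans ?_ (hfgh x y)
  gcongr <;> exact min_le_left _ _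

theorem volume_preserving_fin_cons (n : ℕ) :
    MeasurePreserving fun z : ℝ × (Fin n → ℝ) => (Fin.cons z.1 z.2 : Fin (n + 1) → ℝ) := by
  convert (volume_preserving_piFinSuccAbove (fun _ : Fin (n + 1) => ℝ) 0).symm using 1
  ext z
  simp [MeasurableEquiv.piFinSuccAbove, Fin.insertNthEquiv]

theorem lintegral_fin_succ {n : ℕ} {f : (Fin (n + 1) → ℝ) → ENNReal} (hf : Measurable f) :
    ∫⁻ x, f x = ∫⁻ s : ℝ, ∫⁻ x : Fin n → ℝ, f (Fin.cons s x) := by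
  have hmp := volume_preserving_fin_cons n
  rw [← hmp.lintegral_comp hf, Measure.volume_eq_prod,
    lintegral_prod _ (by exact (hf.comp hmp.measurable).aemeasurable)]

/-- The Prékopa–Leindler inequality on `ℝⁿ`. -/
theorem prekopaLeindler {n : ℕ} {f g h : (Fin n → ℝ) → ENNReal} {a b : ℝ} (ha : 0 < a)
    (hb : 0 < b) (hab : a + b = 1) (hf : Measurable f) (hg : Measurable g) (hh : Measurable h)
    (hfgh : ∀ x y, f x ^ a * g y ^ b ≤ h (a • x + b • y)) :
    (∫⁻ x, f x) ^ a * (∫⁻ x, g x) ^ b ≤ ∫⁻ x, h x := by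
  induction n with
  | zero =>
    have hdefault : ∀ F : (Fin 0 → ℝ) → ENNReal, ∫⁻ x, F x = F default := by
      intro F
      rw [lintegral_unique, volume_pi, Measure.pi_of_empty _ default]
      rw [Measure.dirac_apply_of_mem (mem_univ _), mul_one, Subsingleton.elim (default : Fin 0 → ℝ)]
    rw [hdefault, hdefault, hdefault]
    convert hfgh default default
  | succ n ih =>
    rw [lintegral_fin_succ hf, lintegral_fin_succ hg, lintegral_fin_succ hh]
    have hsec : ∀ {F : (Fin (n + 1) → ℝ) → ENNReal}, Measurable F →
        Measurable fun z : ℝ × (Fin n → ℝ) => F (Fin.cons z.1 z.2) :=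
      fun hF => hF.comp (volume_preserving_fin_cons n).measurable
    refine prekopaLeindler_real ha hb hab (hsec hf).lintegral_prod_right'
      (hsec hg).lintegral_prod_right' (hsec hh).lintegral_prod_right' fun s t => ?_
    refine ih ((hsec hf).comp measurable_prodMk_left) ((hsec hg).comp measurable_prodMk_left)
      ((hsec hh).comp measurable_prodMk_left) fun x y => ?_
    convert hfgh (Fin.cons s x) (Fin.cons t y) using 2
    ext i
    refine Fin.cases ?_ (fun j => ?_) i <;> simp

/-- The multiplicative Brunn–Minkowski inequality for compact sets. -/
theorem volume_rpow_mul_rpow_le {d : ℕ} {A B : Set (EuclideanSpace ℝ (Fin d))} {a b : ℝ}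
    (ha : 0 < a) (hb : 0 < b) (hab : a + b = 1) (hA : IsCompact A) (hB : IsCompact B) :
    volume A ^ a * volume B ^ b ≤ volume (a • A + b • B) := by
  have hC : IsCompact (a • A + b • B) := (hA.smul a).add (hB.smul b)
  have hmp := PiLp.volume_preserving_toLp (Fin d)
  have hvol : ∀ {S : Set (EuclideanSpace ℝ (Fin d))}, MeasurableSet S →
      volume S = ∫⁻ x, indicator (WithLp.toLp 2 ⁻¹' S) 1 x := by
    intro S hS
    rw [lintegral_indicator_one (hmp.measurable hS), hmp.measure_preimage hS.nullMeasurableSet]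
  have hmeas : ∀ {S : Set (EuclideanSpace ℝ (Fin d))}, MeasurableSet S →
      Measurable (indicator (WithLp.toLp 2 ⁻¹' S) (1 : (Fin d → ℝ) → ENNReal)) :=
    fun hS => measurable_one.indicator (hmp.measurable hS)
  rw [hvol hA.measurableSet, hvol hB.measurableSet, hvol hC.measurableSet]
  refine prekopaLeindler ha hb hab (hmeas hA.measurableSet) (hmeas hB.measurableSet)
    (hmeas hC.measurableSet) fun x y => ?_
  by_cases hx : WithLp.toLp 2 x ∈ A
  · by_cases hy : WithLp.toLp 2 y ∈ B
    · have hxy : a • x + b • y ∈ WithLp.toLp 2 ⁻¹' (a • A + b • B) :=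
        add_mem_add (smul_mem_smul_set hx) (smul_mem_smul_set hy)
      rw [indicator_of_mem hxy]
      simp [indicator, hx, hy]
    · simp [indicator, hy, hb]
  · simp [indicator, hx, ha]

theorem Convex.mem_nhds_zero_of_symm {E : Type*} [AddCommGroup E] [Module ℝ E]
    [TopologicalSpace E] [IsTopologicalAddGroup E] [ContinuousSMul ℝ E] {K : Set E}
    (hK : Convex ℝ K) (hinterior : (interior K).Nonempty) (hsymm : ∀ x ∈ K, -x ∈ K) :
    K ∈ nhds 0 := by
  obtain ⟨x, hx⟩ := hinterior
  have h := hK.combo_interior_self_subset_interior (a := 1 / 2) (b := 1 / 2) (by norm_num)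
    (by norm_num) (by norm_num)
    (add_mem_add (smul_mem_smul_set hx) (smul_mem_smul_set (hsymm x (interior_subset hx))))
  rw [smul_neg, add_neg_cancel] at h
  exact mem_interior_iff_mem_nhds.1 h

section SymmetricConvexBody

variable {d : ℕ} {K : Set (EuclideanSpace ℝ (Fin d))}

theorem mem_smul_of_gauge_le (hK : Convex ℝ K) (hclosed : IsClosed K) (h₀ : K ∈ nhds 0)
    {c : ℝ} (hc : 0 < c) {x : EuclideanSpace ℝ (Fin d)} (hx : gauge K x ≤ c) : x ∈ c • K := by
  rw [mem_smul_set_iff_inv_smul_mem₀ hc.ne', ← hclosed.closure_eq,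
    ← gauge_le_one_iff_mem_closure hK h₀, gauge_smul_of_nonneg (inv_nonneg.2 hc.le), smul_eq_mul,
    inv_mul_le_iff₀ hc, mul_one]
  exact hx

theorem card_mul_volume_smul_le_volume_iUnion {N : ℕ} (hK : Convex ℝ K) (h₀ : K ∈ nhds 0)
    (hsymm : ∀ x ∈ K, -x ∈ K) {ρ lam : ℝ} (hρ : 0 < ρ) (hlam : 2 * ρ ≤ lam)
    (p : Fin N → EuclideanSpace ℝ (Fin d))
    (hP : ∀ i j, i ≠ j → lam ≤ gauge K (p i - p j)) :
    N * volume (ρ • K) ≤ volume (⋃ i, ({p i} + ρ • K)) := by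
  have hvol : volume (ρ • interior K) = volume (ρ • K) := by
    rw [Measure.addHaar_smul, Measure.addHaar_smul,
      measure_congr (interior_ae_eq_of_null_frontier (hK.addHaar_frontier volume))]
  have hdisj : Pairwise (Function.onFun Disjoint fun i => ({p i} + ρ • interior K)) := by
    intro i j hij
    rw [Function.onFun, Set.disjoint_left]
    simp only [singleton_add, mem_image]
    rintro _ ⟨_, ⟨x, hx, rfl⟩, rfl⟩ ⟨_, ⟨y, hy, rfl⟩, hxy⟩
    simp only at hxy
    have hsub : p i - p j = ρ • (y + -x) := by
      rw [smul_add, smul_neg, ← sub_eq_add_neg, sub_eq_sub_iff_add_eq_add, ← hxy, add_comm]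
    have h1 := hP i j hij
    rw [hsub, gauge_smul_of_nonneg hρ.le, smul_eq_mul] at h1
    have h2 := gauge_add_le hK (absorbent_nhds_zero h₀) y (-x)
    rw [gauge_neg hsymm] at h2
    have hx' := (gauge_lt_one_iff_mem_interior hK h₀).2 hx
    have hy' := (gauge_lt_one_iff_mem_interior hK h₀).2 hy
    nlinarith
  calc (N : ENNReal) * volume (ρ • K) = ∑ i, volume ({p i} + ρ • interior K) := by
        simp [singleton_add, measure_preimage_add, image_add_left, hvol]
    _ = volume (⋃ i, ({p i} + ρ • interior K)) := by
        rw [measure_iUnion hdisj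
          fun i => ((isOpen_interior.smul₀ hρ.ne').add_left).measurableSet, tsum_fintype]
    _ ≤ volume (⋃ i, ({p i} + ρ • K)) :=
        measure_mono (iUnion_mono fun i => by gcongr; exact interior_subset)

theorem isCompact_iUnion_singleton_add_smul {N : ℕ} (hK : IsCompact K) (r : ℝ)
    (p : Fin N → EuclideanSpace ℝ (Fin d)) : IsCompact (⋃ i, ({p i} + r • K)) :=
  isCompact_iUnion fun _ => isCompact_singleton.add (hK.smul r)

theorem volume_le_volume_add_of_le {A B : Set (EuclideanSpace ℝ (Fin d))} {a b : ℝ}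
    {m : ENNReal} (ha : 0 < a) (hb : 0 < b) (hab : a + b = 1) (hA : IsCompact A)
    (hB : IsCompact B) (hmA : m ≤ volume A) (hmB : m ≤ volume B) :
    m ≤ volume (a • A + b • B) := by
  calc m = m ^ a * m ^ b := by
        rw [← ENNReal.rpow_add_of_nonneg _ _ ha.le hb.le, hab, ENNReal.rpow_one]
    _ ≤ volume A ^ a * volume B ^ b := by gcongr
    _ ≤ volume (a • A + b • B) := volume_rpow_mul_rpow_le ha hb hab hA hB

/-- The isodiametric inequality, for a union of balls whose centers are pairwise at distance
at most `lam`. -/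
theorem volume_iUnion_le_of_gauge_sub_le {N : ℕ} (hKcomp : IsCompact K) (hK : Convex ℝ K)
    (h₀ : K ∈ nhds 0) (hsymm : ∀ x ∈ K, -x ∈ K) {r lam : ℝ} (hr : 0 < r) (hlam : 0 < lam)
    (q : Fin N → EuclideanSpace ℝ (Fin d))
    (hQ : ∀ i j, i ≠ j → gauge K (q i - q j) ≤ lam) :
    volume (⋃ i, ({q i} + r • K)) ≤ volume ((r + lam / 2) • K) := by
  have hA := isCompact_iUnion_singleton_add_smul hKcomp r q
  refine (volume_le_volume_add_of_le (a := 1 / 2) (b := 1 / 2) (by norm_num) (by norm_num)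
    (by norm_num) hA hA.neg le_rfl (Measure.measure_neg volume _).ge).trans (measure_mono ?_)
  rintro _ ⟨_, ⟨x, hx, rfl⟩, _, ⟨y, hy, rfl⟩, rfl⟩
  simp only [mem_neg, mem_iUnion, singleton_add, mem_image] at hx hy
  obtain ⟨i, _, ⟨u, hu, rfl⟩, rfl⟩ := hx
  obtain ⟨j, _, ⟨v, hv, rfl⟩, hy⟩ := hy
  have hq : q i - q j ∈ lam • K := by
    refine mem_smul_of_gauge_le hK hKcomp.isClosed h₀ hlam ?_
    rcases eq_or_ne i j with rfl | hij
    · simpa using hlam.le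
    · exact hQ i j hij
  have hmem : (q i - q j) + (r • u + r • -v) ∈ (lam + (r + r)) • K := by
    rw [hK.add_smul hlam.le (by positivity), hK.add_smul hr.le hr.le]
    exact add_mem_add hq (add_mem_add (smul_mem_smul_set hu) (smul_mem_smul_set (hsymm v hv)))
  have h := smul_mem_smul_set (a := (1 / 2 : ℝ)) hmem
  rw [smul_smul] at h
  convert h using 1
  · congr 1
    ring
  · rw [show y = -(q j + r • v) from neg_eq_iff_eq_neg.1 hy.symm]
    simp only
    module

end SymmetricConvexBody

/-- A uniform contraction does not increase the volume of the union of
`N ≥ 2^d` balls of common radius `r` in the Minkowski space generated by `K`. -/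
theorem union_volume_uniform_contraction
    (d N : ℕ) (hd : 1 < d) (hN : 2 ^ d ≤ N)
    (K : Set (EuclideanSpace ℝ (Fin d)))
    (hKcomp : IsCompact K) (hKconv : Convex ℝ K)
    (hKint : (interior K).Nonempty) (hKsymm : ∀ x ∈ K, -x ∈ K)
    (r lam : ℝ) (hr : 0 < r) (hlam : 0 < lam)
    (p q : Fin N → EuclideanSpace ℝ (Fin d))
    (hQ : ∀ i j, i ≠ j → gauge K (q i - q j) ≤ lam)
    (hP : ∀ i j, i ≠ j → lam ≤ gauge K (p i - p j)) :
    volume (⋃ i, ({q i} + r • K)) ≤ volume (⋃ i, ({p i} + r • K)) := by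
  have h₀ := hKconv.mem_nhds_zero_of_symm hKint hKsymm
  rcases le_or_gt (2 * r) lam with hrl | hrl
  · calc volume (⋃ i, ({q i} + r • K)) ≤ ∑ i, volume ({q i} + r • K) :=
          measure_iUnion_fintype_le _ _
      _ = N * volume (r • K) := by simp [singleton_add, measure_preimage_add, image_add_left]
      _ ≤ _ := card_mul_volume_smul_le_volume_iUnion hKconv h₀ hKsymm hr hrl p hP
  · refine (volume_iUnion_le_of_gauge_sub_le hKcomp hKconv h₀ hKsymm hr hlam q hQ).trans ?_
    set R := r + lam / 2 with hR
    have hRpos : 0 < R := by positivity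
    have hs : 0 < r - lam / 2 := by linarith
    have hpack := card_mul_volume_smul_le_volume_iUnion hKconv h₀ hKsymm (ρ := lam / 2)
      (by positivity) (by linarith) p hP
    have hA : volume (R • K) ≤ volume ((R / lam) • ⋃ i, ({p i} + (lam / 2) • K)) := by
      calc volume (R • K) = 2 ^ d * volume ((R / 2) • K) := by
            have : R • K = (2 : ℝ) • ((R / 2) • K) := by rw [smul_smul]; congr 1; ring
            rw [this, Measure.addHaar_smul]
            simp
        _ ≤ N * volume ((R / 2) • K) := by
            gcongr
            exact_mod_cast hN
        _ = ENNReal.ofReal |(R / lam) ^ d| * (N * volume ((lam / 2) • K)) := by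
            have : (R / 2) • K = (R / lam) • ((lam / 2) • K) := by
              rw [smul_smul]; congr 1; field_simp
            rw [this, Measure.addHaar_smul, finrank_euclideanSpace_fin]
            ring
        _ ≤ ENNReal.ofReal |(R / lam) ^ d| * volume (⋃ i, ({p i} + (lam / 2) • K)) := by
            gcongr
        _ = _ := by rw [Measure.addHaar_smul, finrank_euclideanSpace_fin]
    refine (volume_le_volume_add_of_le (a := lam / R) (b := (r - lam / 2) / R) (by positivity)
      (by positivity) (by field_simp; linarith)
      ((isCompact_iUnion_singleton_add_smul hKcomp (lam / 2) p).smul _) (hKcomp.smul R) hA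
      le_rfl).trans (measure_mono ?_)
    rw [smul_smul, smul_smul, div_mul_div_cancel₀ hRpos.ne', div_self hlam.ne', one_smul,
      div_mul_cancel₀ _ hRpos.ne', iUnion_add]
    refine iUnion_mono fun i => ?_
    rw [add_assoc, ← hKconv.add_smul (by positivity) hs.le, add_sub_cancel]
end

section
/- Let K be an origin-symmetric convex body in R^d which is a generating set, let r > 0, λ > 0, d > 1, N ≥ 3^d. If Q = {q_1,...,q_N} is a uniform contraction of P = {p_1,...,p_N} with separating value λ in the norm generated by K, then V_d(P_K^r) ≤ V_d(Q_K^r), where X_K^r denotes the intersection of the balls B_K[x,r], x ∈ X. -/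
open MeasureTheory Set
open scoped Pointwise

theorem ENNReal.rpow_mul_rpow_le_weighted_add_s2 {s t : ℝ} (hs : 0 < s) (ht : 0 < t) (hst : s + t = 1)
    (a b : ENNReal) :
    a ^ s * b ^ t ≤ ENNReal.ofReal s * a + ENNReal.ofReal t * b := by
  have hs' : ENNReal.ofReal s ≠ 0 := by simpa using hs
  have ht' : ENNReal.ofReal t ≠ 0 := by simpa using ht
  rcases eq_or_ne a ⊤ with rfl | ha
  · simp [ENNReal.mul_top hs']
  rcases eq_or_ne b ⊤ with rfl | hb
  · simp [ENNReal.mul_top ht']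
  lift a to NNReal using ha
  lift b to NNReal using hb
  lift s to NNReal using hs.le
  lift t to NNReal using ht.le
  rw [← ENNReal.coe_rpow_of_nonneg _ hs.le, ← ENNReal.coe_rpow_of_nonneg _ ht.le]
  simp only [ENNReal.ofReal_coe_nnreal]
  exact_mod_cast NNReal.geom_mean_le_arith_mean2_weighted s t a b (by exact_mod_cast hst)

theorem volume_add_volume_le_of_isCompact {A B C : Set ℝ} (hA : IsCompact A) (hB : IsCompact B)
    (hA0 : A.Nonempty) (hB0 : B.Nonempty) {s t : ℝ} (hs : 0 < s) (ht : 0 < t)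
    (hC : ∀ a ∈ A, ∀ b ∈ B, s * a + t * b ∈ C) :
    ENNReal.ofReal s * volume A + ENNReal.ofReal t * volume B ≤ volume C := by
  obtain ⟨a₀, ha₀, hmax⟩ := hA.exists_isGreatest hA0
  obtain ⟨b₀, hb₀, hmin⟩ := hB.exists_isLeast hB0
  have h1 : volume ((t * b₀) +ᵥ s • A) = ENNReal.ofReal s * volume A := by
    rw [measure_vadd, Measure.addHaar_smul]; simp [abs_of_pos hs]
  have h2 : volume ((s * a₀) +ᵥ t • B) = ENNReal.ofReal t * volume B := by
    rw [measure_vadd, Measure.addHaar_smul]; simp [abs_of_pos ht]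
  have hm : MeasurableSet ((s * a₀) +ᵥ t • B) :=
    (((hB.smul t).vadd (s * a₀)).isClosed).measurableSet
  rw [← h1, ← h2, ← measure_union₀ hm.nullMeasurableSet]
  · refine measure_mono (union_subset ?_ ?_)
    · rintro _ ⟨_, ⟨a, ha, rfl⟩, rfl⟩
      simpa [add_comm] using hC a ha b₀ hb₀
    · rintro _ ⟨_, ⟨b, hb, rfl⟩, rfl⟩
      simpa using hC a₀ ha₀ b hb
  · refine measure_mono_null (t := {s * a₀ + t * b₀}) ?_ (by simp)
    rintro _ ⟨⟨_, ⟨a, ha, rfl⟩, rfl⟩, ⟨_, ⟨b, hb, rfl⟩, h⟩⟩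
    simp only [smul_eq_mul, vadd_eq_add, mem_singleton_iff] at h ⊢
    have := mul_le_mul_of_nonneg_left (hmax ha) hs.le
    have := mul_le_mul_of_nonneg_left (hmin hb) ht.le
    linarith

theorem volume_add_volume_le_of_measurableSet {A B C : Set ℝ} (hA : MeasurableSet A)
    (hB : MeasurableSet B) (hA0 : A.Nonempty) (hB0 : B.Nonempty) {s t : ℝ} (hs : 0 < s) (ht : 0 < t)
    (hC : ∀ a ∈ A, ∀ b ∈ B, s * a + t * b ∈ C) :
    ENNReal.ofReal s * volume A + ENNReal.ofReal t * volume B ≤ volume C := by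
  obtain ⟨a₀, ha₀⟩ := hA0
  obtain ⟨b₀, hb₀⟩ := hB0
  rw [hA.measure_eq_iSup_isCompact, hB.measure_eq_iSup_isCompact]
  simp_rw [ENNReal.mul_iSup, iSup_and']
  refine ENNReal.biSup_add_biSup_le' ⟨∅, empty_subset _, isCompact_empty⟩
    ⟨∅, empty_subset _, isCompact_empty⟩ fun K hK L hL => ?_
  refine le_trans ?_ (volume_add_volume_le_of_isCompact (hK.2.insert a₀) (hL.2.insert b₀)
    (insert_nonempty _ _) (insert_nonempty _ _) hs ht fun a ha b hb =>
      hC a (insert_subset ha₀ hK.1 ha) b (insert_subset hb₀ hL.1 hb))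
  gcongr <;> exact subset_insert _ _

theorem lintegral_weighted_add_le {f g h : ℝ → ℝ} (hf : Measurable f) (hg : Measurable g)
    (hh : Measurable h) (hf0 : 0 ≤ f) (hg0 : 0 ≤ g) (hh0 : 0 ≤ h)
    (hf1 : ∀ x, f x ≤ 1) (hg1 : ∀ x, g x ≤ 1)
    (hf2 : ∀ c < 1, ∃ x, c < f x) (hg2 : ∀ c < 1, ∃ x, c < g x) {s t : ℝ} (hs : 0 < s) (ht : 0 < t)
    (hst : s + t = 1) (hfgh : ∀ x y, f x ^ s * g y ^ t ≤ h (s * x + t * y)) :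
    ENNReal.ofReal s * (∫⁻ x, ENNReal.ofReal (f x)) + ENNReal.ofReal t * ∫⁻ x, ENNReal.ofReal (g x) ≤
      ∫⁻ x, ENNReal.ofReal (h x) := by
  have key : ∀ {u : ℝ → ℝ}, Measurable u → 0 ≤ u → (∀ x, u x ≤ 1) →
      ∫⁻ x, ENNReal.ofReal (u x) = ∫⁻ c in Ioo 0 1, volume {x | c < u x} := by
    intro u hu hu0 hu1
    rw [lintegral_eq_lintegral_meas_lt _ (.of_forall hu0) hu.aemeasurable,
      ← Ioo_union_Ici_eq_Ioi zero_lt_one, lintegral_union measurableSet_Ici]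
    · rw [setLIntegral_congr_fun (g := 0) measurableSet_Ici]
      · simp
      · intro c hc
        have : {x | c < u x} = ∅ := by
          ext x; simpa using (hu1 x).trans hc
        simp [this]
    · exact Set.disjoint_left.2 fun x hx hx' => not_le.2 hx.2 hx'
  rw [key hf hf0 hf1, key hg hg0 hg1,
    lintegral_eq_lintegral_meas_lt _ (.of_forall hh0) hh.aemeasurable]
  calc _ ≤ ∫⁻ c in Ioo (0 : ℝ) 1, (ENNReal.ofReal s * volume {x | c < f x} +
        ENNReal.ofReal t * volume {x | c < g x}) :=
        (add_le_add (lintegral_const_mul_le _ _) (lintegral_const_mul_le _ _)).trans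
          (le_lintegral_add _ _)
    _ ≤ ∫⁻ c in Ioo (0 : ℝ) 1, volume {x | c < h x} := by
        refine setLIntegral_mono' measurableSet_Ioo fun c hc => ?_
        refine volume_add_volume_le_of_measurableSet (measurableSet_lt measurable_const hf)
          (measurableSet_lt measurable_const hg) (hf2 c hc.2) (hg2 c hc.2) hs ht ?_
        intro a ha b hb
        refine lt_of_lt_of_le ?_ (hfgh a b)
        calc c = c ^ s * c ^ t := by rw [← Real.rpow_add hc.1, hst, Real.rpow_one]
          _ < _ := mul_lt_mul'' (Real.rpow_lt_rpow hc.1.le ha hs) (Real.rpow_lt_rpow hc.1.le hb ht)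
            (Real.rpow_nonneg hc.1.le _) (Real.rpow_nonneg hc.1.le _)
    _ ≤ _ := lintegral_mono_set Ioo_subset_Ioi_self

/-- The one-dimensional **Prékopa–Leindler inequality** for bounded functions. -/
theorem prekopa_leindler_real {f g h : ℝ → ℝ} (hf : Measurable f) (hg : Measurable g)
    (hh : Measurable h) (hf0 : 0 ≤ f) (hg0 : 0 ≤ g) (hh0 : 0 ≤ h)
    (hfb : BddAbove (range f)) (hgb : BddAbove (range g)) {s t : ℝ} (hs : 0 < s) (ht : 0 < t)
    (hst : s + t = 1) (hfgh : ∀ x y, f x ^ s * g y ^ t ≤ h (s * x + t * y)) :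
    (∫⁻ x, ENNReal.ofReal (f x)) ^ s * (∫⁻ x, ENNReal.ofReal (g x)) ^ t ≤
      ∫⁻ x, ENNReal.ofReal (h x) := by
  have key : ∀ {u : ℝ → ℝ}, Measurable u → 0 ≤ u → BddAbove (range u) →
      (∫⁻ x, ENNReal.ofReal (u x) = 0) ∨ ∃ (U : ℝ) (v : ℝ → ℝ), 0 < U ∧ Measurable v ∧ 0 ≤ v ∧
        (∀ x, v x ≤ 1) ∧ (∀ c < 1, ∃ x, c < v x) ∧ ∀ x, u x = U * v x := by
    intro u hu hu0 hub
    have hle : ∀ x, u x ≤ ⨆ x, u x := le_ciSup hub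
    rcases ((hu0 0).trans (hle 0)).eq_or_lt with h0 | h0
    · left
      have : ∀ x, u x = 0 := fun x => le_antisymm ((hle x).trans_eq h0.symm) (hu0 x)
      simp [this]
    · refine .inr ⟨⨆ x, u x, fun x => u x / ⨆ x, u x, h0, hu.div_const _,
        fun x => div_nonneg (hu0 x) h0.le, fun x => (div_le_one h0).2 (hle x), fun c hc => ?_,
        fun x => (mul_div_cancel₀ _ h0.ne').symm⟩
      obtain ⟨x, hx⟩ := exists_lt_of_lt_ciSup (f := u) (b := c * ⨆ x, u x)
        (mul_lt_of_lt_one_left h0 hc)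
      exact ⟨x, (lt_div_iff₀ h0).2 hx⟩
  rcases key hf hf0 hfb with h0 | ⟨F, f', hF, hf', hf0', hf1', hf2', hff'⟩
  · simp [h0, hs]
  rcases key hg hg0 hgb with h0 | ⟨G, g', hG, hg', hg0', hg1', hg2', hgg'⟩
  · simp [h0, ht]
  set H := F ^ s * G ^ t with hH_def
  have hH : 0 < H := by positivity
  have main := lintegral_weighted_add_le hf' hg' (hh.div_const H) hf0' hg0'
    (fun x => div_nonneg (hh0 x) hH.le) hf1' hg1' hf2' hg2' hs ht hst fun x y => by
      rw [le_div_iff₀ hH]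
      refine le_trans (le_of_eq ?_) (hfgh x y)
      rw [hff', hgg', Real.mul_rpow hF.le (hf0' x), Real.mul_rpow hG.le (hg0' y)]
      ring
  have hscale : ∀ (U : ℝ) (v : ℝ → ℝ), 0 < U → ∫⁻ x, ENNReal.ofReal (U * v x) =
      ENNReal.ofReal U * ∫⁻ x, ENNReal.ofReal (v x) := fun U v hU => by
    simp_rw [ENNReal.ofReal_mul hU.le]
    exact lintegral_const_mul' _ _ ENNReal.ofReal_ne_top
  have hh' : ∀ x, h x = H * (h x / H) := fun x => by field_simp
  simp_rw [hff', hgg']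
  rw [lintegral_congr fun x => congrArg ENNReal.ofReal (hh' x), hscale _ _ hF, hscale _ _ hG,
    hscale _ _ hH, ENNReal.mul_rpow_of_nonneg _ _ hs.le, ENNReal.mul_rpow_of_nonneg _ _ ht.le,
    mul_mul_mul_comm, ENNReal.ofReal_rpow_of_pos hF, ENNReal.ofReal_rpow_of_pos hG,
    ← ENNReal.ofReal_mul (by positivity)]
  gcongr
  exact (ENNReal.rpow_mul_rpow_le_weighted_add_s2 hs ht hst _ _).trans main

/-- The multiplicative form of the **Brunn–Minkowski inequality** for compact subsets of `E`. -/
def HasBrunnMinkowski (E : Type*) [AddCommGroup E] [Module ℝ E] [TopologicalSpace E]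
    [MeasureSpace E] : Prop :=
  ∀ ⦃s t : ℝ⦄, 0 < s → 0 < t → s + t = 1 → ∀ ⦃A B C : Set E⦄, IsCompact A → IsCompact B →
    IsCompact C → (∀ a ∈ A, ∀ b ∈ B, s • a + t • b ∈ C) →
    volume A ^ s * volume B ^ t ≤ volume C

namespace HasBrunnMinkowski

theorem of_continuousLinearEquiv {E F : Type*} [AddCommGroup E] [Module ℝ E] [TopologicalSpace E]
    [MeasureSpace E] [AddCommGroup F] [Module ℝ F] [TopologicalSpace F] [T2Space F] [MeasureSpace F]
    [OpensMeasurableSpace F]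
    (hE : HasBrunnMinkowski F) (e : E ≃L[ℝ] F) (he : MeasurePreserving e) :
    HasBrunnMinkowski E := by
  intro s t hs ht hst A B C hA hB hC h
  have hvol : ∀ {S : Set E}, IsCompact S → volume S = volume (e '' S) := fun {S} hS => by
    rw [← he.measure_preimage (hS.image e.continuous).measurableSet.nullMeasurableSet,
      e.injective.preimage_image]
  rw [hvol hA, hvol hB, hvol hC]
  refine hE hs ht hst (hA.image e.continuous) (hB.image e.continuous) (hC.image e.continuous) ?_
  rintro _ ⟨a, ha, rfl⟩ _ ⟨b, hb, rfl⟩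
  exact ⟨s • a + t • b, h a ha b hb, by simp⟩

theorem prod_real {E : Type*} [AddCommGroup E] [Module ℝ E] [TopologicalSpace E] [T2Space E]
    [SecondCountableTopology E] [MeasureSpace E] [BorelSpace E]
    [SigmaFinite (volume : Measure E)] [IsFiniteMeasureOnCompacts (volume : Measure E)]
    (hE : HasBrunnMinkowski E) : HasBrunnMinkowski (ℝ × E) := by
  intro s t hs ht hst A B C hA hB hC h
  have hsec : ∀ {S : Set (ℝ × E)}, IsCompact S → ∀ x, IsCompact (Prod.mk x ⁻¹' S) := fun hS x =>
    (hS.image continuous_snd).of_isClosed_subset (hS.isClosed.preimage (by fun_prop))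
      fun y hy => ⟨(x, y), hy, rfl⟩
  have hvol : ∀ {S : Set (ℝ × E)}, IsCompact S →
      volume S = ∫⁻ x, ENNReal.ofReal (volume.real (Prod.mk x ⁻¹' S)) := fun {S} hS => by
    rw [Measure.volume_eq_prod, Measure.prod_apply hS.measurableSet]
    exact lintegral_congr fun x => (ENNReal.ofReal_toReal (hsec hS x).measure_ne_top).symm
  have hmeas : ∀ {S : Set (ℝ × E)}, IsCompact S →
      Measurable fun x => volume.real (Prod.mk x ⁻¹' S) := fun hS =>
    (measurable_measure_prodMk_left hS.measurableSet).ennreal_toReal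
  have hbdd : ∀ {S : Set (ℝ × E)}, IsCompact S →
      BddAbove (range fun x => volume.real (Prod.mk x ⁻¹' S)) := fun {S} hS => by
    refine ⟨volume.real (Prod.snd '' S), ?_⟩
    rintro _ ⟨x, rfl⟩
    exact measureReal_mono (fun y hy => ⟨(x, y), hy, rfl⟩)
      (hS.image continuous_snd).measure_ne_top
  rw [hvol hA, hvol hB, hvol hC]
  refine prekopa_leindler_real (hmeas hA) (hmeas hB) (hmeas hC) (fun _ => measureReal_nonneg)
    (fun _ => measureReal_nonneg) (fun _ => measureReal_nonneg) (hbdd hA) (hbdd hB) hs ht hst ?_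
  intro x y
  have := ENNReal.toReal_mono (hsec hC _).measure_ne_top
    (hE hs ht hst (hsec hA x) (hsec hB y) (hsec hC (s * x + t * y))
      fun a ha b hb => h (x, a) ha (y, b) hb)
  simpa [Measure.real, ENNReal.toReal_mul, ENNReal.toReal_rpow] using this

theorem pi_fin (n : ℕ) : HasBrunnMinkowski (Fin n → ℝ) := by
  induction n with
  | zero =>
    intro s t hs ht hst A B C hA hB hC h
    rcases A.eq_empty_or_nonempty with rfl | ⟨a, ha⟩
    · simp [hs]
    rcases B.eq_empty_or_nonempty with rfl | ⟨b, hb⟩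
    · simp [ht]
    rw [Subsingleton.eq_univ_of_nonempty ⟨a, ha⟩, Subsingleton.eq_univ_of_nonempty ⟨b, hb⟩,
      Subsingleton.eq_univ_of_nonempty ⟨_, h a ha b hb⟩]
    simp [volume_pi]
  | succ n ih =>
    exact ih.prod_real.of_continuousLinearEquiv (Fin.consEquivL ℝ fun _ : Fin (n + 1) => ℝ).symm
      (volume_preserving_piFinSuccAbove (fun _ : Fin (n + 1) => ℝ) 0)

theorem euclideanSpace (n : ℕ) : HasBrunnMinkowski (EuclideanSpace ℝ (Fin n)) :=
  (pi_fin n).of_continuousLinearEquiv (EuclideanSpace.equiv (Fin n) ℝ)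
    (PiLp.volume_preserving_ofLp (Fin n))

end HasBrunnMinkowski

theorem HasBrunnMinkowski.add_le_of_pow_mul_volume_le {d : ℕ} (hd : d ≠ 0)
    {A B K : Set (EuclideanSpace ℝ (Fin d))} (hA : IsCompact A) (hB : IsCompact B)
    (hK : IsCompact K) (hK0 : volume K ≠ 0) {α β R : ℝ} (hα : 0 < α) (hβ : 0 < β) (hR : 0 ≤ R)
    (hAα : ENNReal.ofReal (α ^ d) * volume K ≤ volume A)
    (hBβ : ENNReal.ofReal (β ^ d) * volume K ≤ volume B)
    (hAB : ∀ a ∈ A, ∀ b ∈ B, a + b ∈ R • K) : α + β ≤ R := by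
  have hαβ : 0 < α + β := add_pos hα hβ
  have hscale : ∀ {c : ℝ} {S : Set (EuclideanSpace ℝ (Fin d))}, 0 < c →
      ENNReal.ofReal (c ^ d) * volume K ≤ volume S → volume K ≤ volume (c⁻¹ • S) := by
    intro c S hc h
    rw [Measure.addHaar_smul, finrank_euclideanSpace_fin, abs_of_pos (by positivity)]
    refine le_trans (le_of_eq ?_) (mul_le_mul_right h _)
    rw [← mul_assoc, ← ENNReal.ofReal_mul (by positivity), inv_pow,
      inv_mul_cancel₀ (by positivity), ENNReal.ofReal_one, one_mul]
  have hst : α / (α + β) + β / (α + β) = 1 := by field_simp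
  have main := euclideanSpace d (div_pos hα hαβ) (div_pos hβ hαβ) hst
    (hA.smul α⁻¹) (hB.smul β⁻¹) (hK.smul (R / (α + β))) <| by
      rintro _ ⟨a, ha, rfl⟩ _ ⟨b, hb, rfl⟩
      obtain ⟨k, hk, hkab⟩ := hAB a ha b hb
      refine ⟨k, hk, ?_⟩
      simp only at hkab ⊢
      rw [div_eq_inv_mul R, mul_smul, hkab, smul_add, smul_smul, smul_smul]
      congr 2 <;> field_simp
  have hle : volume K ≤ volume ((R / (α + β)) • K) := by
    refine le_trans ?_ main
    calc volume K = volume K ^ (α / (α + β)) * volume K ^ (β / (α + β)) := by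
          rw [← ENNReal.rpow_add _ _ hK0 hK.measure_ne_top, hst, ENNReal.rpow_one]
      _ ≤ _ := by
          exact mul_le_mul' (ENNReal.rpow_le_rpow (hscale hα hAα) (by positivity))
            (ENNReal.rpow_le_rpow (hscale hβ hBβ) (by positivity))
  rw [Measure.addHaar_smul, finrank_euclideanSpace_fin, abs_of_nonneg (by positivity)] at hle
  by_contra! hlt
  have hlt1 : (R / (α + β)) ^ d < 1 := pow_lt_one₀ (by positivity) ((div_lt_one hαβ).2 hlt) hd
  refine hle.not_gt ?_
  calc _ < 1 * volume K :=
        ENNReal.mul_lt_mul_left hK0 hK.measure_ne_top (by simpa using hlt1)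
    _ = _ := one_mul _

theorem Convex.zero_mem_interior_of_neg_mem {E : Type*} [AddCommGroup E] [Module ℝ E]
    [TopologicalSpace E] [IsTopologicalAddGroup E] [ContinuousSMul ℝ E] {K : Set E}
    (hK : Convex ℝ K) (hint : (interior K).Nonempty) (hsymm : ∀ x ∈ K, -x ∈ K) :
    (0 : E) ∈ interior K := by
  obtain ⟨x, hx⟩ := hint
  have h := hK.combo_interior_self_mem_interior hx (hsymm x (interior_subset hx))
    (a := 1 / 2) (b := 1 / 2) (by norm_num) (by norm_num) (by norm_num)
  simpa using h

theorem Convex.mem_smul_iff_gauge_le {E : Type*} [AddCommGroup E] [Module ℝ E]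
    [TopologicalSpace E] [IsTopologicalAddGroup E] [ContinuousSMul ℝ E] {K : Set E}
    (hK : Convex ℝ K) (hclosed : IsClosed K) (h0 : K ∈ nhds 0) {c : ℝ} (hc : 0 < c) {x : E} :
    x ∈ c • K ↔ gauge K x ≤ c := by
  rw [mem_smul_set_iff_inv_smul_mem₀ hc.ne']
  nth_rw 1 [← hclosed.closure_eq]
  rw [← gauge_le_one_iff_mem_closure hK h0, gauge_smul_of_nonneg (inv_nonneg.2 hc.le), smul_eq_mul,
    inv_mul_le_one₀ hc]

theorem volume_iUnion_vadd_ge_of_le_gauge {d N : ℕ} {K : Set (EuclideanSpace ℝ (Fin d))}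
    (hK : Convex ℝ K) (h0 : K ∈ nhds 0) (hsymm : ∀ x ∈ K, -x ∈ K) {c : ℝ} (hc : 0 < c)
    {p : Fin N → EuclideanSpace ℝ (Fin d)} (hp : ∀ i j, i ≠ j → 2 * c ≤ gauge K (p i - p j)) :
    N * (ENNReal.ofReal (c ^ d) * volume K) ≤ volume (⋃ i, p i +ᵥ c • K) := by
  have hgauge : ∀ {x y : EuclideanSpace ℝ (Fin d)}, x ∈ y +ᵥ c • interior K →
      gauge K (x - y) < c := by
    rintro _ y ⟨_, ⟨k, hk, rfl⟩, rfl⟩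
    have := interior_subset_gauge_lt_one K hk
    simpa [gauge_smul_of_nonneg hc.le] using mul_lt_of_lt_one_right hc this
  have hvol : volume (interior K) = volume K :=
    measure_interior_of_null_frontier (hK.addHaar_frontier volume)
  calc _ = ∑ i, volume (p i +ᵥ c • interior K) := by
        simp [measure_vadd, Measure.addHaar_smul, hvol, abs_of_pos hc]
    _ = volume (⋃ i, p i +ᵥ c • interior K) := by
        rw [measure_iUnion, tsum_fintype]
        · intro i j hij
          refine Set.disjoint_left.2 fun x hi hj => ?_
          have h1 := hgauge hi
          have h2 := hgauge hj
          rw [← gauge_neg hsymm, neg_sub] at h1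
          have := gauge_add_le hK (absorbent_nhds_zero h0) (p i - x) (x - p j)
          rw [sub_add_sub_cancel] at this
          linarith [hp i j hij]
        · exact fun i => ((isOpen_interior.smul₀ hc.ne').vadd (p i)).measurableSet
    _ ≤ _ := measure_mono (iUnion_mono fun i =>
        vadd_set_mono (smul_set_mono interior_subset))

/-- If the o-symmetric convex body `K` is a generating set
(every nonempty intersection of translates of `K` is a summand of `K`), `N ≥ 3^d`,
and `Q` is a uniform contraction of `P` with separating value `λ`, then the volume of
the intersection of the `N` balls of radius `r` centered at the `pᵢ` is at most that
of the balls centered at the `qᵢ`. -/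
theorem intersection_volume_uniform_contraction
    (d N : ℕ) (hd : 1 < d) (hN : 3 ^ d ≤ N)
    (K : Set (EuclideanSpace ℝ (Fin d)))
    (hKcomp : IsCompact K) (hKconv : Convex ℝ K)
    (hKint : (interior K).Nonempty) (hKsymm : ∀ x ∈ K, -x ∈ K)
    (hKgen : ∀ C : Set (EuclideanSpace ℝ (Fin d)), C.Nonempty →
      (⋂ x ∈ C, ({x} + K)).Nonempty →
      ∃ A'' : Set (EuclideanSpace ℝ (Fin d)), IsCompact A'' ∧ Convex ℝ A'' ∧
        (⋂ x ∈ C, ({x} + K)) + A'' = K)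
    (r lam : ℝ) (hr : 0 < r) (hlam : 0 < lam)
    (p q : Fin N → EuclideanSpace ℝ (Fin d))
    (hQ : ∀ i j, i ≠ j → gauge K (q i - q j) ≤ lam)
    (hP : ∀ i j, i ≠ j → lam ≤ gauge K (p i - p j)) :
    volume (⋂ i, ({p i} + r • K)) ≤ volume (⋂ i, ({q i} + r • K)) := by
  have h0 : K ∈ nhds 0 :=
    mem_interior_iff_mem_nhds.1 (hKconv.zero_mem_interior_of_neg_mem hKint hKsymm)
  have hadd := gauge_add_le hKconv (absorbent_nhds_zero h0)
  have hsmul : ∀ {c : ℝ}, 0 < c → ∀ {x}, x ∈ c • K ↔ gauge K x ≤ c := fun hc =>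
    hKconv.mem_smul_iff_gauge_le hKcomp.isClosed h0 hc
  have hball : ∀ {x y}, x ∈ {y} + r • K ↔ gauge K (x - y) ≤ r := fun {x y} => by
    rw [← hsmul hr, singleton_add, image_add_left, mem_preimage, neg_add_eq_sub]
  have hK0 : volume K ≠ 0 := (Measure.measure_pos_of_nonempty_interior _ hKint).ne'
  have : NeZero N := ⟨(lt_of_lt_of_le (by positivity) hN).ne'⟩
  set W := ⋂ i, ({p i} + r • K)
  have hcomp : ∀ i, IsCompact ({p i} + r • K) := fun i =>
    isCompact_singleton.add (hKcomp.smul r)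
  have hWcomp : IsCompact W :=
    (hcomp 0).of_isClosed_subset (isClosed_iInter fun i => (hcomp i).isClosed) (iInter_subset _ 0)
  rcases eq_or_ne (volume W) 0 with hW0 | hW0
  · simp [hW0]
  have hd0 : d ≠ 0 := by lia
  obtain ⟨ω, hω, hωW⟩ : ∃ ω : ℝ, 0 < ω ∧ ENNReal.ofReal (ω ^ d) * volume K = volume W := by
    have hKpos : 0 < volume.real K := ENNReal.toReal_pos hK0 hKcomp.measure_ne_top
    have hpos : 0 < volume.real W / volume.real K :=
      div_pos (ENNReal.toReal_pos hW0 hWcomp.measure_ne_top) hKpos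
    refine ⟨(volume.real W / volume.real K) ^ (d⁻¹ : ℝ), Real.rpow_pos_of_pos hpos _, ?_⟩
    rw [Real.rpow_inv_natCast_pow hpos.le hd0, ENNReal.ofReal_div_of_pos hKpos,
      ofReal_measureReal hWcomp.measure_ne_top, ofReal_measureReal hKcomp.measure_ne_top,
      ENNReal.div_mul_cancel hK0 hKcomp.measure_ne_top]
  have hω_le : 3 * (lam / 2) + ω ≤ r + lam / 2 := by
    refine HasBrunnMinkowski.add_le_of_pow_mul_volume_le hd0
      (A := ⋃ i, p i +ᵥ (lam / 2) • K) (B := -W)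
      (isCompact_iUnion fun i => (hKcomp.smul _).vadd _) hWcomp.neg hKcomp hK0 (by positivity) hω
      (by positivity) ?_ (by rw [Measure.measure_neg, hωW]) ?_
    · refine le_trans ?_ (volume_iUnion_vadd_ge_of_le_gauge hKconv h0 hKsymm (half_pos hlam)
        fun i j hij => (by linarith [hP i j hij]))
      rw [mul_pow, ENNReal.ofReal_mul (by positivity), mul_assoc]
      gcongr
      rw [ENNReal.ofReal_pow (by norm_num)]
      exact_mod_cast hN
    · intro a ha b hb
      obtain ⟨i, k, hk, rfl⟩ := mem_iUnion.1 ha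
      have h1 := hball.1 (mem_iInter.1 hb i)
      have h2 := gauge_le_of_mem (half_pos hlam).le hk
      rw [← gauge_neg hKsymm] at h1
      rw [hsmul (by positivity)]
      refine le_trans (le_of_eq ?_) ((hadd _ _).trans (add_le_add h1 h2))
      congr 1
      simp only [vadd_eq_add]
      abel
  have hρ : 0 ≤ r - lam := by linarith
  calc volume W = ENNReal.ofReal (ω ^ d) * volume K := hωW.symm
    _ ≤ ENNReal.ofReal ((r - lam) ^ d) * volume K := by
        gcongr
        linarith
    _ = volume (q 0 +ᵥ (r - lam) • K) := by
        rw [measure_vadd, Measure.addHaar_smul, finrank_euclideanSpace_fin,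
          abs_of_nonneg (by positivity)]
    _ ≤ _ := by
        refine measure_mono (subset_iInter fun i => ?_)
        rintro _ ⟨k, hk, rfl⟩
        have h1 : gauge K (q 0 - q i) ≤ lam := by
          rcases eq_or_ne 0 i with rfl | hi
          · simpa using hlam.le
          · exact hQ 0 i hi
        have h2 := gauge_le_of_mem hρ hk
        rw [hball]
        have h3 := hadd (q 0 - q i) k
        rw [sub_add_eq_add_sub] at h3
        simp only [vadd_eq_add]
        linarith
end
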